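/- Let n ∈ ℕ₀, λ ∈ ℂ with λ+1 not a nonpositive integer, and x ∈ (−1,1). Then the Ferrers function of the first kind is given by the specialized Meixner polynomial: 𝖯_{n+λ}^{−λ}(x) = ((1−x²)^{λ/2}/(2^λ Γ(λ+1))) M_n(−2λ−n−1; λ+1, 2/(1+x)). -/

import Mathlib

/-- Pochhammer symbol `(a)_k = a (a+1) ⋯ (a+k-1)` for complex `a`. -/
noncomputable def cpoch (a : ℂ) (k : ℕ) : ℂ := ∏ i ∈ Finset.range k, (a + i)

/-- Gauss hypergeometric series `₂F₁(a, b; c; z)`. -/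
noncomputable def hyp2F1 (a b c z : ℂ) : ℂ :=
  ∑' k : ℕ, cpoch a k * cpoch b k / (cpoch c k * (Nat.factorial k : ℂ)) * z ^ k

/-- Ferrers function of the first kind `𝖯_ν^{−μ}(x)`. -/
noncomputable def ferrersP (ν μ : ℂ) (x : ℝ) : ℂ :=
  (1 / Complex.Gamma (μ + 1)) * (((1 - x) / (1 + x) : ℝ) : ℂ) ^ (μ / 2) *
    hyp2F1 (-ν) (ν + 1) (μ + 1) (((1 - x) / 2 : ℝ) : ℂ)

/-- Meixner polynomial `M_n(x; β, c)`. -/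
noncomputable def meixnerM (n : ℕ) (x β c : ℂ) : ℂ :=
  hyp2F1 (-(n : ℂ)) (-x) β (1 - 1 / c)

open PowerSeries in
/-- The left-hand side of the hypergeometric differential equation, for formal power series. -/
noncomputable def hypODE (a b c : ℂ) (f : ℂ⟦X⟧) : ℂ⟦X⟧ :=
  X * (1 - X) * d⁄dX ℂ (d⁄dX ℂ f) + (C c - (C a + C b + 1) * X) * d⁄dX ℂ f - C a * C b * f

open PowerSeries in
theorem coeff_hypODE (a b c : ℂ) (f : ℂ⟦X⟧) (m : ℕ) :
    coeff m (hypODE a b c f) =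
      (m + 1) * (m + c) * coeff (m + 1) f - (m + a) * (m + b) * coeff m f := by
  have h : hypODE a b c f = X * d⁄dX ℂ (d⁄dX ℂ f) - X * (X * d⁄dX ℂ (d⁄dX ℂ f)) +
      C c * d⁄dX ℂ f - C (a + b + 1) * (X * d⁄dX ℂ f) - C (a * b) * f := by
    simp only [hypODE, map_add, map_mul, map_one]
    ring
  simp only [h, map_sub (coeff m), map_add (coeff m), coeff_C_mul]
  rcases m with _ | _ | m
  · simp only [coeff_zero_X_mul, coeff_derivative]
    push_cast
    ring
  · simp only [coeff_succ_X_mul, coeff_zero_X_mul, coeff_derivative]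
    push_cast
    ring
  · simp only [coeff_succ_X_mul, coeff_derivative]
    push_cast
    ring

open PowerSeries in
theorem hypODE_eq_zero_iff (a b c : ℂ) (f : ℂ⟦X⟧) :
    hypODE a b c f = 0 ↔
      ∀ m : ℕ, (m + 1) * (m + c) * coeff (m + 1) f = (m + a) * (m + b) * coeff m f := by
  simp only [PowerSeries.ext_iff, coeff_hypODE, map_zero, sub_eq_zero]

open PowerSeries in
/-- If `B` behaves like `(1 - X) ^ (c - a - b)`, multiplication by `B` transports solutions of the
hypergeometric equation with parameters `c - a`, `c - b`, `c` to parameters `a`, `b`, `c`. -/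
theorem hypODE_mul_eq_zero (a b c : ℂ) {B P : ℂ⟦X⟧}
    (hB : (1 - X) * d⁄dX ℂ B + C (c - a - b) * B = 0) (hP : hypODE (c - a) (c - b) c P = 0) :
    hypODE a b c (B * P) = 0 := by
  have hX : (1 - X : ℂ⟦X⟧) ≠ 0 := by
    intro h
    simpa using congrArg constantCoeff h
  have hB' : (1 - X) * d⁄dX ℂ (d⁄dX ℂ B) - d⁄dX ℂ B + C (c - a - b) * d⁄dX ℂ B = 0 := by
    have := congrArg (d⁄dX ℂ) hB
    simp only [map_add, Derivation.leibniz, map_sub, derivative_X, derivative_C, derivative_one,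
      smul_eq_mul, map_zero] at this
    simp only [map_sub]
    linear_combination this
  refine (mul_eq_zero.mp ?_).resolve_left hX
  simp only [hypODE, map_sub, map_add, Derivation.leibniz, smul_eq_mul] at *
  linear_combination (1 - X) * X * P * hB' +
    ((C c - (C a + C b + 1) * X) * P + 2 * X * (1 - X) * d⁄dX ℂ P
      + X * P * (1 - (C c - C a - C b))) * hB + (1 - X) * B * hP

theorem cpoch_succ (a : ℂ) (k : ℕ) : cpoch a (k + 1) = cpoch a k * (a + k) :=
  Finset.prod_range_succ _ _

theorem cpoch_ne_zero {c : ℂ} (hc : ∀ k : ℕ, c ≠ -(k : ℂ)) (k : ℕ) : cpoch c k ≠ 0 :=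
  Finset.prod_ne_zero_iff.mpr fun i _ h => hc i (eq_neg_of_add_eq_zero_left h)

theorem cpoch_neg_natCast_eq_zero {n k : ℕ} (h : n < k) : cpoch (-(n : ℂ)) k = 0 :=
  Finset.prod_eq_zero (Finset.mem_range.mpr h) (neg_add_cancel _)

/-- The coefficients of the Gauss hypergeometric series. -/
noncomputable def hypCoeff (a b c : ℂ) (k : ℕ) : ℂ :=
  cpoch a k * cpoch b k / (cpoch c k * (Nat.factorial k : ℂ))

theorem hypCoeff_succ {c : ℂ} (a b : ℂ) (hc : ∀ k : ℕ, c ≠ -(k : ℂ)) (k : ℕ) :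
    (k + 1) * (k + c) * hypCoeff a b c (k + 1) = (k + a) * (k + b) * hypCoeff a b c k := by
  have h1 := cpoch_ne_zero hc k
  have h2 : c + k ≠ 0 := fun h => hc k (eq_neg_of_add_eq_zero_left h)
  have h3 : (k + 1 : ℂ) ≠ 0 := by exact_mod_cast k.succ_ne_zero
  have h4 : (Nat.factorial k : ℂ) ≠ 0 := by exact_mod_cast k.factorial_ne_zero
  simp only [hypCoeff, cpoch_succ, Nat.factorial_succ]
  push_cast
  field_simp
  ring

theorem hyp2F1_comm (a b c z : ℂ) : hyp2F1 a b c z = hyp2F1 b a c z := by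
  simp only [hyp2F1, mul_comm (cpoch a _)]

/-- The coefficient of `z ^ k` in `(1 - z) ^ s`. -/
noncomputable def binomCoeff (s : ℂ) (k : ℕ) : ℂ := (-1) ^ k * Ring.choose s k

theorem binomCoeff_succ (s : ℂ) (k : ℕ) :
    (k + 1) * binomCoeff s (k + 1) = (k - s) * binomCoeff s k := by
  have h3 : (k + 1 : ℂ) ≠ 0 := by exact_mod_cast k.succ_ne_zero
  have h4 : (Nat.factorial k : ℂ) ≠ 0 := by exact_mod_cast k.factorial_ne_zero
  simp only [binomCoeff, Ring.choose_eq_smul, descPochhammer_succ_right, Polynomial.smeval_mul,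
    Polynomial.smeval_sub, Polynomial.smeval_X, Polynomial.smeval_natCast, Nat.factorial_succ,
    smul_eq_mul, nsmul_eq_mul, pow_zero, pow_one]
  push_cast
  field_simp
  ring

theorem hasSum_binomCoeff (s : ℂ) {z : ℂ} (hz : ‖z‖ < 1) :
    HasSum (fun k => binomCoeff s k * z ^ k) ((1 - z) ^ s) := by
  have hz' : -z ∈ Metric.eball (0 : ℂ) 1 := by
    rw [← ENNReal.ofReal_one, Metric.eball_ofReal]
    simpa using hz
  have := (Complex.one_add_cpow_hasFPowerSeriesOnBall_zero (a := s)).hasSum hz'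
  simp only [binomialSeries_apply, List.ofFn_const, List.prod_replicate, zero_add,
    smul_eq_mul] at this
  have h : ∀ k, binomCoeff s k * z ^ k = Ring.choose s k * (-z) ^ k := fun k => by
    rw [binomCoeff, neg_pow z]
    ring
  simpa only [h, sub_eq_add_neg] using this

theorem summable_norm_binomCoeff (s : ℂ) {z : ℂ} (hz : ‖z‖ < 1) :
    Summable fun k => ‖binomCoeff s k * z ^ k‖ :=
  (hasSum_binomCoeff s hz).summable.norm

theorem sum_antidiagonal_binomCoeff_mul_hypCoeff {c : ℂ} (a b : ℂ) (hc : ∀ k : ℕ, c ≠ -(k : ℂ))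
    (m : ℕ) :
    ∑ p ∈ Finset.HasAntidiagonal.antidiagonal m, binomCoeff (c - a - b) p.1 * hypCoeff (c - a) (c - b) c p.2 =
      hypCoeff a b c m := by
  set B : PowerSeries ℂ := .mk (binomCoeff (c - a - b)) with hBdef
  set P : PowerSeries ℂ := .mk (hypCoeff (c - a) (c - b) c) with hPdef
  have hB : (1 - PowerSeries.X) * PowerSeries.derivative ℂ B + PowerSeries.C (c - a - b) * B
      = 0 := by
    ext k
    have h := binomCoeff_succ (c - a - b)
    rcases k with _ | k
    · have := h 0
      simp only [sub_mul, one_mul, map_add, map_sub, PowerSeries.coeff_zero_X_mul,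
        PowerSeries.coeff_derivative, PowerSeries.coeff_C_mul, hBdef, PowerSeries.coeff_mk,
        map_zero] at this ⊢
      push_cast at this ⊢
      linear_combination this
    · have := h (k + 1)
      simp only [sub_mul, one_mul, map_add, map_sub, PowerSeries.coeff_succ_X_mul,
        PowerSeries.coeff_derivative, PowerSeries.coeff_C_mul, hBdef, PowerSeries.coeff_mk,
        map_zero] at this ⊢
      push_cast at this ⊢
      linear_combination this
  have hP : hypODE (c - a) (c - b) c P = 0 := by
    simpa [hypODE_eq_zero_iff, hPdef] using hypCoeff_succ (c - a) (c - b) hc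
  have hG := (hypODE_eq_zero_iff _ _ _ _).mp (hypODE_mul_eq_zero a b c hB hP)
  suffices H : PowerSeries.coeff m (B * P) = hypCoeff a b c m by
    simpa [PowerSeries.coeff_mul, hBdef, hPdef] using H
  induction m with
  | zero => simp [hBdef, hPdef, binomCoeff, hypCoeff, cpoch]
  | succ m ih =>
    have h2 : (m + c : ℂ) ≠ 0 := fun h => hc m (eq_neg_of_add_eq_zero_right h)
    have h3 : (m + 1 : ℂ) ≠ 0 := by exact_mod_cast m.succ_ne_zero
    refine mul_left_cancel₀ (mul_ne_zero h3 h2) ?_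
    rw [hG, hypCoeff_succ a b hc, ih]

/-- **Euler's transformation** of the Gauss hypergeometric series. -/
theorem hyp2F1_eq_one_sub_cpow_mul {c z : ℂ} (a b : ℂ) (hc : ∀ k : ℕ, c ≠ -(k : ℂ))
    (hz : ‖z‖ < 1) (hs : Summable fun k => ‖hypCoeff (c - a) (c - b) c k * z ^ k‖) :
    hyp2F1 a b c z = (1 - z) ^ (c - a - b) * hyp2F1 (c - a) (c - b) c z := by
  change ∑' k, hypCoeff a b c k * z ^ k = _ * ∑' k, hypCoeff (c - a) (c - b) c k * z ^ k
  rw [← (hasSum_binomCoeff _ hz).tsum_eq,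
    tsum_mul_tsum_eq_tsum_sum_antidiagonal_of_summable_norm (summable_norm_binomCoeff _ hz) hs]
  refine tsum_congr fun m => ?_
  rw [← sum_antidiagonal_binomCoeff_mul_hypCoeff a b hc, Finset.sum_mul]
  refine Finset.sum_congr rfl fun p hp => ?_
  rw [← Finset.HasAntidiagonal.mem_antidiagonal.mp hp, pow_add]
  ring

theorem summable_norm_hypCoeff_neg_natCast (n : ℕ) (b c z : ℂ) :
    Summable fun k => ‖hypCoeff (-(n : ℂ)) b c k * z ^ k‖ := by
  refine summable_of_ne_finset_zero (s := Finset.range (n + 1)) fun k hk => ?_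
  have hnk : n < k := not_le.mp fun h => hk (Finset.mem_range.mpr (Nat.lt_succ_of_le h))
  rw [hypCoeff, cpoch_neg_natCast_eq_zero hnk]
  simp

theorem one_sub_div_one_add_cpow_mul {x : ℝ} (hx : x ∈ Set.Ioo (-1 : ℝ) 1) (s : ℂ) :
    (((1 - x) / (1 + x) : ℝ) : ℂ) ^ (s / 2) * (((1 + x) / 2 : ℝ) : ℂ) ^ s =
      ((1 - x ^ 2 : ℝ) : ℂ) ^ (s / 2) / (2 : ℂ) ^ s := by
  have h1 : 0 < 1 - x := by linarith [hx.2]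
  have h2 : 0 < 1 + x := by linarith [hx.1]
  have hpos : 0 < 1 - x ^ 2 := by nlinarith
  have key : ∀ {r : ℝ}, 0 < r → ∀ w : ℂ, (r : ℂ) ^ w = Complex.exp (Real.log r * w) := by
    intro r hr w
    rw [Complex.cpow_def_of_ne_zero (by exact_mod_cast hr.ne'), Complex.ofReal_log hr.le]
  have h2s : (2 : ℂ) ^ s = Complex.exp (Real.log 2 * s) := by
    simpa using key two_pos s
  rw [key (div_pos h1 h2), key (half_pos h2), key hpos, h2s, ← Complex.exp_add, ← Complex.exp_sub,
    show 1 - x ^ 2 = (1 - x) * (1 + x) by ring, Real.log_mul h1.ne' h2.ne',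
    Real.log_div h1.ne' h2.ne', Real.log_div h2.ne' two_ne_zero]
  congr 1
  push_cast
  ring

theorem ferrersP_eq_meixner (n : ℕ) (lam : ℂ) (hlam : ∀ k : ℕ, lam + 1 ≠ -(k : ℂ))
    (x : ℝ) (hx : x ∈ Set.Ioo (-1 : ℝ) 1) :
    ferrersP ((n : ℂ) + lam) lam x =
      (((1 - x ^ 2 : ℝ) : ℂ) ^ (lam / 2) / ((2 : ℂ) ^ lam * Complex.Gamma (lam + 1))) *
        meixnerM n (-2 * lam - n - 1) (lam + 1) (2 / (1 + (x : ℂ))) := by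
  set z : ℂ := (((1 - x) / 2 : ℝ) : ℂ) with hzdef
  have hz : ‖z‖ < 1 := by
    rw [hzdef, Complex.norm_real, Real.norm_eq_abs, abs_lt]
    constructor <;> linarith [hx.1, hx.2]
  have ha : lam + 1 - ((n : ℂ) + lam + 1) = -(n : ℂ) := by ring
  have hb : lam + 1 - (-((n : ℂ) + lam)) = -(-2 * lam - n - 1) := by ring
  have euler := hyp2F1_eq_one_sub_cpow_mul ((n : ℂ) + lam + 1) (-((n : ℂ) + lam)) hlam hz
    (by rw [ha]; exact summable_norm_hypCoeff_neg_natCast n _ _ z)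
  rw [show lam + 1 - ((n : ℂ) + lam + 1) - (-((n : ℂ) + lam)) = lam by ring, ha, hb,
    show 1 - z = (((1 + x) / 2 : ℝ) : ℂ) by rw [hzdef]; push_cast; ring] at euler
  have harg : 1 - 1 / (2 / (1 + (x : ℂ))) = z := by
    rw [hzdef, one_div_div]
    push_cast
    ring
  rw [ferrersP, meixnerM, harg, hyp2F1_comm, ← hzdef, euler, ← div_div,
    ← one_sub_div_one_add_cpow_mul hx]
  ring
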